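/- (Example 3: involutivity for a system with separation relations cubic in momenta.) On ℝ⁶ with coordinates (q₁,q₂,q₃,p₁,p₂,p₃), define h₁^{(1)} = p₂p₃ + (1/3)p₂² + p₃² − 7q₁²p₃ − 4q₁²p₂ − 3q₂p₁ + 18q₁q₂² + 13q₁⁴ + 12q₃q₁q₂; h₁^{(2)} = 12q₁³q₂ + 8q₁³q₃ − 2q₁²p₁ + (−6q₁q₂ − 4q₁q₃)p₃ + p₁p₃; h₂^{(2)} = (1/3)p₂p₃² + (1/3)p₂²p₃ + (2/27)p₂³ − q₁²p₃² − (4/3)q₁²p₂² − q₂p₁p₂ − q₁p₁² − (10/3)q₁²p₃p₂ + (q₃ − 3q₂)p₁p₃ + (21q₁²q₂ + 6q₃q₁²)p₁ + (4q₃q₁q₂ + 6q₁q₂² + (22/3)q₁⁴)p₂ + (7q₁⁴ + 18q₁q₂² + 6q₃q₁q₂ − 4q₁q₃²)p₃ − 8q₁³q₃² − 72q₃q₁³q₂ − 90q₁³q₂² − 12q₁⁶. Then {h₁^{(1)}, h₁^{(2)}} = 0, {h₁^{(1)}, h₂^{(2)}} = 0, and {h₁^{(2)}, h₂^{(2)}}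 = 0 identically on ℝ⁶, where {·,·} is the canonical Poisson bracket. -/

import Mathlib

noncomputable section Stmt17

/-- Partial derivative in the `i`-th coordinate direction on `ℝ⁶`. -/
def pd (i : Fin 6) (F : (Fin 6 → ℝ) → ℝ) (x : Fin 6 → ℝ) : ℝ :=
  fderiv ℝ F x (Pi.single i 1)

/-- The canonical Poisson bracket on `ℝ⁶` with coordinates
`(q₁,q₂,q₃,p₁,p₂,p₃) = (x 0, x 1, x 2, x 3, x 4, x 5)`. -/
def pb (F G : (Fin 6 → ℝ) → ℝ) (x : Fin 6 → ℝ) : ℝ :=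
  (pd 0 F x * pd 3 G x - pd 3 F x * pd 0 G x) +
  (pd 1 F x * pd 4 G x - pd 4 F x * pd 1 G x) +
  (pd 2 F x * pd 5 G x - pd 5 F x * pd 2 G x)

def h11 (x : Fin 6 → ℝ) : ℝ :=
  x 4 * x 5 + (1/3) * x 4 ^ 2 + x 5 ^ 2 - 7 * x 0 ^ 2 * x 5 - 4 * x 0 ^ 2 * x 4
    - 3 * x 1 * x 3 + 18 * x 0 * x 1 ^ 2 + 13 * x 0 ^ 4 + 12 * x 2 * x 0 * x 1

def h12 (x : Fin 6 → ℝ) : ℝ :=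
  12 * x 0 ^ 3 * x 1 + 8 * x 0 ^ 3 * x 2 - 2 * x 0 ^ 2 * x 3
    + (-6 * x 0 * x 1 - 4 * x 0 * x 2) * x 5 + x 3 * x 5

def h22 (x : Fin 6 → ℝ) : ℝ :=
  (1/3) * x 4 * x 5 ^ 2 + (1/3) * x 4 ^ 2 * x 5 + (2/27) * x 4 ^ 3
    - x 0 ^ 2 * x 5 ^ 2 - (4/3) * x 0 ^ 2 * x 4 ^ 2 - x 1 * x 3 * x 4
    - x 0 * x 3 ^ 2 - (10/3) * x 0 ^ 2 * x 5 * x 4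
    + (x 2 - 3 * x 1) * x 3 * x 5 + (21 * x 0 ^ 2 * x 1 + 6 * x 2 * x 0 ^ 2) * x 3
    + (4 * x 2 * x 0 * x 1 + 6 * x 0 * x 1 ^ 2 + (22/3) * x 0 ^ 4) * x 4
    + (7 * x 0 ^ 4 + 18 * x 0 * x 1 ^ 2 + 6 * x 2 * x 0 * x 1 - 4 * x 0 * x 2 ^ 2) * x 5
    - 8 * x 0 ^ 3 * x 2 ^ 2 - 72 * x 2 * x 0 ^ 3 * x 1 - 90 * x 0 ^ 3 * x 1 ^ 2
    - 12 * x 0 ^ 6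

theorem pd_add' (i : Fin 6) (f g : (Fin 6 → ℝ) → ℝ) (x : Fin 6 → ℝ)
    (hf : Differentiable ℝ f) (hg : Differentiable ℝ g) :
    pd i (fun y => f y + g y) x = pd i f x + pd i g x := by
  unfold pd
  rw [fderiv_fun_add (hf x) (hg x)]; rfl

theorem pd_sub' (i : Fin 6) (f g : (Fin 6 → ℝ) → ℝ) (x : Fin 6 → ℝ)
    (hf : Differentiable ℝ f) (hg : Differentiable ℝ g) :
    pd i (fun y => f y - g y) x = pd i f x - pd i g x := by
  unfold pd
  rw [fderiv_fun_sub (hf x) (hg x)]; rfl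

theorem pd_mul' (i : Fin 6) (f g : (Fin 6 → ℝ) → ℝ) (x : Fin 6 → ℝ)
    (hf : Differentiable ℝ f) (hg : Differentiable ℝ g) :
    pd i (fun y => f y * g y) x = f x * pd i g x + g x * pd i f x := by
  unfold pd
  rw [fderiv_fun_mul (hf x) (hg x)]; simp

theorem pd_pow' (i : Fin 6) (f : (Fin 6 → ℝ) → ℝ) (n : ℕ) (x : Fin 6 → ℝ)
    (hf : Differentiable ℝ f) :
    pd i (fun y => f y ^ n) x = n * f x ^ (n - 1) * pd i f x := by
  unfold pd
  rw [fderiv_fun_pow n (hf x)]; simp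

theorem pd_const' (i : Fin 6) (c : ℝ) (x : Fin 6 → ℝ) :
    pd i (fun _ => c) x = 0 := by
  simp [pd]

theorem pd_coord (i j : Fin 6) (x : Fin 6 → ℝ) :
    pd i (fun y => y j) x = if j = i then 1 else 0 := by
  unfold pd
  rw [(hasFDerivAt_apply j x).fderiv]
  simp [Pi.single_apply]

set_option maxHeartbeats 2000000 in
theorem pd_h11 (i : Fin 6) (x : Fin 6 → ℝ) :
    pd i h11 x = ((-14) * x 0 * x 5 + (-8) * x 0 * x 4 + (18) * x 1 ^ 2 + (52) * x 0 ^ 3 + (12) * x 1 * x 2) * (if 0 = i then 1 else 0)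
      + ((-3) * x 3 + (36) * x 0 * x 1 + (12) * x 0 * x 2) * (if 1 = i then 1 else 0)
      + ((12) * x 0 * x 1) * (if 2 = i then 1 else 0)
      + ((-3) * x 1) * (if 3 = i then 1 else 0)
      + ((1) * x 5 + (2 / 3) * x 4 + (-4) * x 0 ^ 2) * (if 4 = i then 1 else 0)
      + ((1) * x 4 + (2) * x 5 + (-7) * x 0 ^ 2) * (if 5 = i then 1 else 0) := by
  unfold h11
  simp (disch := fun_prop) only [pd_add', pd_sub', pd_mul', pd_pow', pd_const', pd_coord]
  norm_num only
  ring

set_option maxHeartbeats 2000000 in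
theorem pd_h12 (i : Fin 6) (x : Fin 6 → ℝ) :
    pd i h12 x = ((36) * x 0 ^ 2 * x 1 + (24) * x 0 ^ 2 * x 2 + (-4) * x 0 * x 3 + (-6) * x 1 * x 5 + (-4) * x 2 * x 5) * (if 0 = i then 1 else 0)
      + ((12) * x 0 ^ 3 + (-6) * x 0 * x 5) * (if 1 = i then 1 else 0)
      + ((8) * x 0 ^ 3 + (-4) * x 0 * x 5) * (if 2 = i then 1 else 0)
      + ((-2) * x 0 ^ 2 + (1) * x 5) * (if 3 = i then 1 else 0)
      + (0) * (if 4 = i then 1 else 0)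
      + ((-6) * x 0 * x 1 + (-4) * x 0 * x 2 + (1) * x 3) * (if 5 = i then 1 else 0) := by
  unfold h12
  simp (disch := fun_prop) only [pd_add', pd_sub', pd_mul', pd_pow', pd_const', pd_coord]
  norm_num only
  ring

set_option maxHeartbeats 2000000 in
theorem pd_h22 (i : Fin 6) (x : Fin 6 → ℝ) :
    pd i h22 x = ((-2) * x 0 * x 5 ^ 2 + (-8 / 3) * x 0 * x 4 ^ 2 + (-1) * x 3 ^ 2 + (-20 / 3) * x 0 * x 4 * x 5 + (42) * x 0 * x 1 * x 3 + (12) * x 0 * x 2 * x 3 + (4) * x 1 * x 2 * x 4 + (6) * x 1 ^ 2 * x 4 + (88 / 3) * x 0 ^ 3 * x 4 + (28) * x 0 ^ 3 * x 5 + (18) * x 1 ^ 2 * x 5 + (6) * x 1 * x 2 * x 5 + (-4) * x 2 ^ 2 * x 5 + (-24) * x 0 ^ 2 * x 2 ^ 2 + (-216) * x 0 ^ 2 * x 1 * x 2 + (-270) * x 0 ^ 2 * x 1 ^ 2 + (-72) * x 0 ^ 5) * (if 0 = i then 1 else 0)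
      + ((-1) * x 3 * x 4 + (-3) * x 3 * x 5 + (21) * x 0 ^ 2 * x 3 + (4) * x 0 * x 2 * x 4 + (12) * x 0 * x 1 * x 4 + (36) * x 0 * x 1 * x 5 + (6) * x 0 * x 2 * x 5 + (-72) * x 0 ^ 3 * x 2 + (-180) * x 0 ^ 3 * x 1) * (if 1 = i then 1 else 0)
      + ((1) * x 3 * x 5 + (6) * x 0 ^ 2 * x 3 + (4) * x 0 * x 1 * x 4 + (6) * x 0 * x 1 * x 5 + (-8) * x 0 * x 2 * x 5 + (-16) * x 0 ^ 3 * x 2 + (-72) * x 0 ^ 3 * x 1) * (if 2 = i then 1 else 0)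
      + ((-1) * x 1 * x 4 + (-2) * x 0 * x 3 + (1) * x 2 * x 5 + (-3) * x 1 * x 5 + (21) * x 0 ^ 2 * x 1 + (6) * x 0 ^ 2 * x 2) * (if 3 = i then 1 else 0)
      + ((1 / 3) * x 5 ^ 2 + (2 / 3) * x 4 * x 5 + (2 / 9) * x 4 ^ 2 + (-8 / 3) * x 0 ^ 2 * x 4 + (-1) * x 1 * x 3 + (-10 / 3) * x 0 ^ 2 * x 5 + (4) * x 0 * x 1 * x 2 + (6) * x 0 * x 1 ^ 2 + (22 / 3) * x 0 ^ 4) * (if 4 = i then 1 else 0)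
      + ((2 / 3) * x 4 * x 5 + (1 / 3) * x 4 ^ 2 + (-2) * x 0 ^ 2 * x 5 + (-10 / 3) * x 0 ^ 2 * x 4 + (1) * x 2 * x 3 + (-3) * x 1 * x 3 + (7) * x 0 ^ 4 + (18) * x 0 * x 1 ^ 2 + (6) * x 0 * x 1 * x 2 + (-4) * x 0 * x 2 ^ 2) * (if 5 = i then 1 else 0) := by
  unfold h22
  simp (disch := fun_prop) only [pd_add', pd_sub', pd_mul', pd_pow', pd_const', pd_coord]
  norm_num only
  ring

set_option maxHeartbeats 1000000 in
/-- Example 3: involutivity for a system with separation relations cubic in momenta. -/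
theorem stmt17 : ∀ x : Fin 6 → ℝ,
    pb h11 h12 x = 0 ∧ pb h11 h22 x = 0 ∧ pb h12 h22 x = 0 := by
  intro x
  refine ⟨?_, ?_, ?_⟩ <;>
  · simp only [pb, pd_h11, pd_h12, pd_h22, Fin.reduceEq, if_true, if_false, mul_zero, mul_one,
      add_zero, zero_add]
    ring

end Stmt17
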